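/- Let M be a map from datasets of n points in a sample space 𝒳 to ℝ^p with ℓ2-sensitivity at most Δ, i.e. ‖M(x) − M(x')‖ ≤ Δ for every pair of adjacent datasets x, x'. Let 0 < ε < 1, 0 < δ < 1, and let σ ≥ √(2 log(1.25/δ)) · Δ / ε. Then the Gaussian mechanism 𝒢(x) = M(x) + b, where b ~ N(0, σ² I_p) is independent Gaussian noise, is (ε,δ)-differentially private: for every pair of adjacent datasets x, x' and every Borel set S ⊆ ℝ^p, P(M(x) + b ∈ S) ≤ e^ε · P(M(x') + b ∈ S) + δ. -/

import Mathlib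

open MeasureTheory ProbabilityTheory Real
open scoped ENNReal

noncomputable section

/-- Two datasets of `n` points are adjacent if they differ in exactly one entry. -/
def Adjacent {n : ℕ} {𝒳 : Type*} (x x' : Fin n → 𝒳) : Prop :=
  ∃ i, x i ≠ x' i ∧ ∀ j, j ≠ i → x j = x' j

/-- The law of `p`-dimensional Gaussian noise `N(0, σ² I_p)`: a product of `p` independent
centered one-dimensional Gaussian measures of variance `σ²`. -/
def gaussianNoise (p : ℕ) (σ : ℝ) : Measure (Fin p → ℝ) :=
  Measure.pi fun _ => gaussianReal 0 (Real.toNNReal (σ ^ 2))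

open scoped NNReal

/-- A product of probability measures with densities has the product density. -/
lemma pi_withDensity {ι : Type*} [Fintype ι] {α : ι → Type*} [∀ i, MeasurableSpace (α i)]
    (μ : ∀ i, Measure (α i)) [∀ i, IsProbabilityMeasure (μ i)] (f : ∀ i, α i → ℝ≥0∞)
    (hf : ∀ i, Measurable (f i)) [∀ i, SigmaFinite ((μ i).withDensity (f i))] :
    Measure.pi (fun i => (μ i).withDensity (f i)) =
      (Measure.pi μ).withDensity (fun x => ∏ i, f i (x i)) := by
  refine Measure.pi_eq fun s hs => ?_
  rw [withDensity_apply _ (MeasurableSet.univ_pi hs),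
    ← lintegral_indicator (MeasurableSet.univ_pi hs)]
  have hind : ∀ x : ∀ i, α i, (Set.univ.pi s).indicator (fun x => ∏ i, f i (x i)) x =
      ∏ i, (s i).indicator (f i) (x i) := by
    intro x
    by_cases hx : x ∈ Set.univ.pi s
    · rw [Set.indicator_of_mem hx]
      exact Finset.prod_congr rfl fun i _ => (Set.indicator_of_mem (hx i trivial) _).symm
    · rw [Set.indicator_of_notMem hx]
      simp only [Set.mem_pi, not_forall] at hx
      obtain ⟨i, _, hi⟩ := hx
      exact (Finset.prod_eq_zero (Finset.mem_univ i) (Set.indicator_of_notMem hi _)).symm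
  have hmeas : ∀ i, Measurable ((s i).indicator (f i)) := fun i => (hf i).indicator (hs i)
  have hindep : iIndepFun (fun i (x : ∀ i, α i) => (s i).indicator (f i) (x i)) (Measure.pi μ) :=
    iIndepFun_pi fun i => (hmeas i).aemeasurable
  simp_rw [hind]
  rw [lintegral_prod_eq_prod_lintegral_of_indepFun Finset.univ _ hindep
    (fun i => (hmeas i).comp (measurable_pi_apply i))]
  refine Finset.prod_congr rfl fun i _ => ?_
  rw [(measurePreserving_eval μ i).lintegral_comp (hmeas i), lintegral_indicator (hs i),
    withDensity_apply _ (hs i)]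

/-- The Cameron–Martin formula on the line. -/
lemma gaussianReal_eq_withDensity_exp (m : ℝ) {v : ℝ≥0} (hv : v ≠ 0) :
    gaussianReal m v = (gaussianReal 0 v).withDensity
      (fun x => ENNReal.ofReal (exp ((m * x - m ^ 2 / 2) / v))) := by
  rw [gaussianReal_of_var_ne_zero m hv, gaussianReal_of_var_ne_zero 0 hv,
    ← withDensity_mul _ (measurable_gaussianPDF 0 v) (by fun_prop)]
  congr 1
  ext x
  have hv' : (v : ℝ) ≠ 0 := by exact_mod_cast hv
  simp only [Pi.mul_apply, gaussianPDF]
  rw [← ENNReal.ofReal_mul (gaussianPDFReal_nonneg _ _ _)]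
  simp only [gaussianPDFReal]
  rw [mul_assoc _ (exp _), ← exp_add]
  congr 3
  field_simp
  ring

lemma gaussianReal_Ioi_zero_le {v : ℝ≥0} :
    gaussianReal 0 v (Set.Ioi 0) ≤ ENNReal.ofReal (1 / 2) := by
  have hsymm : gaussianReal 0 v (Set.Iio 0) = gaussianReal 0 v (Set.Ioi 0) := by
    conv_lhs => rw [← neg_zero, ← gaussianReal_map_neg, neg_zero]
    rw [Measure.map_apply measurable_neg measurableSet_Iio]
    congr 1
    ext x
    simp
  have hdisj : Disjoint (Set.Iio (0 : ℝ)) (Set.Ioi 0) :=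
    Set.disjoint_left.2 fun x hx hx' => lt_asymm (Set.mem_Iio.1 hx) (Set.mem_Ioi.1 hx')
  have hle : gaussianReal 0 v (Set.Iio 0 ∪ Set.Ioi 0) ≤ 1 := prob_le_one
  rw [measure_union hdisj measurableSet_Ioi, hsymm, ← two_mul, mul_comm] at hle
  rw [ENNReal.ofReal_div_of_pos two_pos]
  simpa using ENNReal.le_div_iff_mul_le (by simp) (by simp) |>.2 hle

lemma gaussianReal_Ioi_le_exp {a : ℝ} (ha : 0 ≤ a) :
    gaussianReal 0 1 (Set.Ioi a) ≤ ENNReal.ofReal (exp (-a ^ 2 / 2) / 2) := by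
  have hshift : gaussianReal 0 1 (Set.Ioi a) = gaussianReal (-a) 1 (Set.Ioi 0) := by
    have h := gaussianReal_map_sub_const (μ := 0) (v := 1) a
    rw [zero_sub] at h
    rw [← h, Measure.map_apply (by fun_prop) measurableSet_Ioi]
    congr 1
    ext x
    simp
  rw [hshift, gaussianReal_eq_withDensity_exp (-a) one_ne_zero,
    withDensity_apply _ measurableSet_Ioi]
  calc _ ≤ ∫⁻ _ in Set.Ioi (0 : ℝ), ENNReal.ofReal (exp (-a ^ 2 / 2)) ∂gaussianReal 0 1 := by
        refine setLIntegral_mono measurable_const fun x hx => ?_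
        refine ENNReal.ofReal_le_ofReal (exp_le_exp.2 ?_)
        have : 0 ≤ a * x := mul_nonneg ha (le_of_lt hx)
        rw [NNReal.coe_one, div_one]
        linarith
    _ ≤ ENNReal.ofReal (exp (-a ^ 2 / 2)) * ENNReal.ofReal (1 / 2) := by
        rw [setLIntegral_const]
        gcongr
        exact gaussianReal_Ioi_zero_le
    _ = _ := by
        rw [← ENNReal.ofReal_mul (exp_nonneg _)]
        congr 1
        ring

lemma gaussianReal_Ioi_le_of_nonpos {a : ℝ} (ha : a ≤ 0) :
    gaussianReal 0 1 (Set.Ioi a) ≤ ENNReal.ofReal ((1 - a) / 2) := by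
  have hIoc : gaussianReal 0 1 (Set.Ioc a 0) ≤ ENNReal.ofReal (-a / 2) := by
    rw [gaussianReal_apply 0 one_ne_zero]
    calc _ ≤ ∫⁻ _ in Set.Ioc a 0, ENNReal.ofReal (1 / 2) := by
          refine setLIntegral_mono measurable_const fun x _ => ?_
          rw [gaussianPDF]
          gcongr
          have hsqrt : 2 ≤ √(2 * π) := by
            refine Real.le_sqrt_of_sq_le ?_
            linarith [pi_gt_three]
          have hexp : exp (-x ^ 2 / 2) ≤ 1 := exp_le_one_iff.2 (by nlinarith [sq_nonneg x])
          simp only [gaussianPDFReal, NNReal.coe_one, mul_one, sub_zero]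
          calc _ ≤ (√(2 * π))⁻¹ * 1 := by gcongr
            _ ≤ 1 / 2 := by rw [mul_one, one_div]; gcongr
      _ = _ := by
          rw [setLIntegral_const, Real.volume_Ioc, ← ENNReal.ofReal_mul (by norm_num)]
          congr 1
          ring
  rw [← Set.Ioc_union_Ioi_eq_Ioi ha]
  calc _ ≤ ENNReal.ofReal (-a / 2) + ENNReal.ofReal (1 / 2) :=
        (measure_union_le _ _).trans (add_le_add hIoc gaussianReal_Ioi_zero_le)
    _ = _ := by
        rw [← ENNReal.ofReal_add (by linarith) (by norm_num)]
        congr 1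
        ring

/-- The tail of the privacy loss, with `t` the noise-to-shift ratio times `ε`. -/
lemma gaussianReal_privacy_tail_le {ε δ t : ℝ} (hε1 : ε < 1) (hδ : 0 < δ)
    (hδ1 : δ < 1) (ht : √(2 * log (1.25 / δ)) ≤ t) :
    gaussianReal 0 1 (Set.Ioi (t - ε / (2 * t))) ≤ ENNReal.ofReal δ := by
  have hlog : 1 / 5 ≤ log (1.25 / δ) := by
    have h1 := one_sub_inv_le_log_of_pos (show 0 < 1.25 / δ by positivity)
    rw [inv_div] at h1
    have : δ / 1.25 ≤ 4 / 5 := by rw [div_le_iff₀ (by norm_num)]; linarith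
    linarith
  have hsq : 2 * log (1.25 / δ) ≤ t ^ 2 := (Real.sqrt_le_iff.1 ht).2
  have ht0 : 0 ≤ t := (Real.sqrt_nonneg _).trans ht
  have ht6 : 3 / 5 < t := by nlinarith
  have htδ : 1.25 * exp (-t ^ 2 / 2) ≤ δ := by
    have : exp (-t ^ 2 / 2) ≤ exp (-log (1.25 / δ)) := exp_le_exp.2 (by linarith)
    rw [exp_neg, exp_log (by positivity), inv_div] at this
    calc _ ≤ 1.25 * (δ / 1.25) := by gcongr
      _ = δ := by field_simp
  have hmul : ε / (2 * t) * t = ε / 2 := by field_simp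
  set q := ε / (2 * t) with hq
  rcases le_or_gt 0 (t - q) with ha | ha
  · refine (gaussianReal_Ioi_le_exp ha).trans (ENNReal.ofReal_le_ofReal (le_trans ?_ htδ))
    have h1 : exp (-(t - q) ^ 2 / 2) ≤ exp (1 / 2) * exp (-t ^ 2 / 2) := by
      rw [← exp_add]
      exact exp_le_exp.2 (by nlinarith [sq_nonneg q])
    have h2 : exp (1 / 2) ≤ 2 := by
      have := add_one_le_exp (-(1 / 2) : ℝ)
      rw [exp_neg] at this
      have h3 : (2 : ℝ)⁻¹ ≤ (exp (1 / 2))⁻¹ := by linarith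
      exact (inv_le_inv₀ two_pos (exp_pos _)).1 h3
    have h4 := exp_pos (-t ^ 2 / 2)
    nlinarith
  · refine (gaussianReal_Ioi_le_of_nonpos ha.le).trans (ENNReal.ofReal_le_ofReal ?_)
    have htt : t ^ 2 ≤ 1 / 2 := by nlinarith
    have h1 := add_one_le_exp (-t ^ 2 / 2)
    have hq1 : q ≤ 5 / 6 := by
      rw [hq, div_le_iff₀ (by linarith)]
      linarith
    linarith

/-- Linear functionals of isotropic Gaussian noise are Gaussian. -/
lemma gaussianNoise_map_linear {p : ℕ} (σ : ℝ) (w : Fin p → ℝ) :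
    (gaussianNoise p σ).map (fun b => ∑ i, w i * b i) =
      gaussianReal 0 (Real.toNNReal ((∑ i, w i ^ 2) * σ ^ 2)) := by
  have hX : ∀ i, HasGaussianLaw (fun b : Fin p → ℝ => w i * b i) (gaussianNoise p σ) := fun i => by
    constructor
    have h : (gaussianNoise p σ).map (fun b => w i * b i) =
        (gaussianReal 0 (Real.toNNReal (σ ^ 2))).map (fun x => w i * x) := by
      rw [← (measurePreserving_eval (fun _ : Fin p => gaussianReal 0 (Real.toNNReal (σ ^ 2)))
        i).map_eq, Measure.map_map (by fun_prop) (by fun_prop)]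
      rfl
    rw [h, gaussianReal_map_const_mul]
    infer_instance
  have hindep : iIndepFun (fun i (b : Fin p → ℝ) => w i * b i) (gaussianNoise p σ) :=
    iIndepFun_pi (X := fun i x => w i * x) fun i => by fun_prop
  have hmeas : Measurable fun b : Fin p → ℝ => ∑ i, w i * b i := by fun_prop
  have hmean : ∫ b, ∑ i, w i * b i ∂gaussianNoise p σ = 0 := by
    rw [integral_finsetSum _ fun i _ => (hX i).integrable]
    refine Finset.sum_eq_zero fun i _ => ?_
    have h := integral_comp_eval (i := i)
      (μ := fun _ : Fin p => gaussianReal 0 (Real.toNNReal (σ ^ 2)))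
      (f := fun x : ℝ => x) aestronglyMeasurable_id
    rw [integral_id_gaussianReal] at h
    rw [integral_const_mul, gaussianNoise, h, mul_zero]
  have hvar : Var[fun b => ∑ i, w i * b i; gaussianNoise p σ] = (∑ i, w i ^ 2) * σ ^ 2 := by
    have hsum : (fun b : Fin p → ℝ => ∑ i, w i * b i) =
        ∑ i, fun b : Fin p → ℝ => (fun x => w i * id x) (b i) := by
      ext b
      simp
    rw [hsum, gaussianNoise, variance_sum_pi fun i => IsGaussian.memLp_two_id.const_mul _]
    simp_rw [variance_const_mul, variance_id_gaussianReal, Real.coe_toNNReal _ (sq_nonneg σ),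
      Finset.sum_mul]
  rw [IsGaussian.eq_gaussianReal _ (hindep.hasGaussianLaw_fun_sum hX).isGaussian_map,
    variance_map aemeasurable_id hmeas.aemeasurable,
    integral_map hmeas.aemeasurable aestronglyMeasurable_id]
  simp only [id_eq, Function.id_comp]
  rw [hmean, hvar]

/-- The Cameron–Martin formula for isotropic Gaussian noise. -/
lemma gaussianNoise_map_const_add {p : ℕ} {σ : ℝ} (hσ : σ ≠ 0) (w : Fin p → ℝ) :
    (gaussianNoise p σ).map (fun b => w + b) = (gaussianNoise p σ).withDensity
      (fun b => ENNReal.ofReal (exp ((∑ i, w i * b i - (∑ i, w i ^ 2) / 2) / σ ^ 2))) := by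
  have hv : Real.toNNReal (σ ^ 2) ≠ 0 := by
    rw [Ne, Real.toNNReal_eq_zero, not_le]
    positivity
  have hmap : (gaussianNoise p σ).map (fun b => w + b) =
      Measure.pi fun i => gaussianReal (w i) (Real.toNNReal (σ ^ 2)) := by
    have h := Measure.pi_map_pi (μ := fun _ : Fin p => gaussianReal 0 (Real.toNNReal (σ ^ 2)))
      (f := fun i x => w i + x) (fun i => by fun_prop)
    simp_rw [gaussianReal_map_const_add, zero_add] at h
    exact h
  have hfin : ∀ i, IsProbabilityMeasure ((gaussianReal 0 (Real.toNNReal (σ ^ 2))).withDensity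
      (fun x => ENNReal.ofReal (exp ((w i * x - w i ^ 2 / 2) / Real.toNNReal (σ ^ 2))))) := by
    intro i
    rw [← gaussianReal_eq_withDensity_exp _ hv]
    infer_instance
  rw [hmap]
  simp_rw [fun i => gaussianReal_eq_withDensity_exp (w i) hv]
  rw [pi_withDensity _ _ (fun i => by fun_prop)]
  rw [gaussianNoise]
  congr 1
  ext b
  rw [← ENNReal.ofReal_prod_of_nonneg fun i _ => exp_nonneg _, ← exp_sum,
    ← Finset.sum_div, Finset.sum_sub_distrib, ← Finset.sum_div,
    Real.coe_toNNReal _ (sq_nonneg σ)]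

/-- Gaussian noise and its shift by `w` are `(ε, δ)`-indistinguishable whenever `σ` is large
compared with the Euclidean length of `w`. -/
lemma gaussianNoise_preimage_add_le {p : ℕ} {ε δ σ : ℝ} {w : Fin p → ℝ}
    (hε : 0 < ε) (hε1 : ε < 1) (hδ : 0 < δ) (hδ1 : δ < 1)
    (hw : 0 < √(∑ i, w i ^ 2))
    (hσ : √(2 * log (1.25 / δ)) * √(∑ i, w i ^ 2) / ε ≤ σ)
    {T : Set (Fin p → ℝ)} (hT : MeasurableSet T) :
    gaussianNoise p σ {b | w + b ∈ T} ≤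
      ENNReal.ofReal (exp ε) * gaussianNoise p σ T + ENNReal.ofReal δ := by
  set d := √(∑ i, w i ^ 2) with hd
  have hd2 : ∑ i, w i ^ 2 = d ^ 2 := (Real.sq_sqrt (Finset.sum_nonneg fun i _ => sq_nonneg _)).symm
  have hlog : 0 < log (1.25 / δ) := log_pos (by rw [lt_div_iff₀ hδ]; linarith)
  have hσ0 : 0 < σ := lt_of_lt_of_le (by positivity) hσ
  have hlin : Measurable fun b : Fin p → ℝ => ∑ i, w i * b i := by fun_prop
  set A : Set (Fin p → ℝ) := {b | ∑ i, w i * b i ≤ ε * σ ^ 2 + d ^ 2 / 2} with hA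
  have hAm : MeasurableSet A := measurableSet_le hlin measurable_const
  have hgood : gaussianNoise p σ {b | w + b ∈ T ∩ A} ≤
      ENNReal.ofReal (exp ε) * gaussianNoise p σ T := by
    change gaussianNoise p σ ((fun b => w + b) ⁻¹' (T ∩ A)) ≤ _
    rw [← Measure.map_apply (by fun_prop) (hT.inter hAm), gaussianNoise_map_const_add hσ0.ne',
      withDensity_apply _ (hT.inter hAm)]
    calc _ ≤ ∫⁻ _ in T ∩ A, ENNReal.ofReal (exp ε) ∂gaussianNoise p σ := by
          refine setLIntegral_mono measurable_const fun b hb => ?_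
          gcongr
          rw [div_le_iff₀ (by positivity), hd2]
          have := hb.2
          simp only [hA, Set.mem_ofPred_eq] at this
          linarith
      _ ≤ _ := by
          rw [setLIntegral_const]
          gcongr
          exact Set.inter_subset_left
  have hbad : gaussianNoise p σ {b | w + b ∈ Aᶜ} ≤ ENNReal.ofReal δ := by
    have ht : √(2 * log (1.25 / δ)) ≤ σ * ε / d := by
      rw [le_div_iff₀ hw]
      rwa [div_le_iff₀ hε] at hσ
    refine le_trans (le_of_eq ?_) (gaussianReal_privacy_tail_le hε1 hδ hδ1 ht)
    have hscale := gaussianReal_map_const_mul (μ := 0) (v := 1) (d * σ)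
    have hvar : NNReal.mk ((d * σ) ^ 2) (sq_nonneg _) * 1 = Real.toNNReal (d ^ 2 * σ ^ 2) := by
      rw [mul_one, ← mul_pow]
      exact (Real.toNNReal_of_nonneg (sq_nonneg _)).symm
    have hlaw := gaussianNoise_map_linear σ w
    rw [mul_zero, hvar] at hscale
    rw [hd2, ← hscale] at hlaw
    have hset := congrArg (fun μ => μ (Set.Ioi (ε * σ ^ 2 - d ^ 2 / 2))) hlaw
    rw [Measure.map_apply hlin measurableSet_Ioi,
      Measure.map_apply (by fun_prop) measurableSet_Ioi] at hset
    convert hset using 2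
    · ext b
      simp only [hA, Set.mem_ofPred_eq, Set.mem_compl_iff, Set.mem_preimage, Set.mem_Ioi, not_le,
        Pi.add_apply, mul_add, Finset.sum_add_distrib, ← sq, hd2]
      constructor <;> intro h <;> linarith
    · ext x
      simp only [Set.mem_preimage, Set.mem_Ioi]
      have : ε * σ ^ 2 - d ^ 2 / 2 = d * σ * (σ * ε / d - ε / (2 * (σ * ε / d))) := by
        field_simp
      rw [this, mul_lt_mul_iff_right₀ (by positivity)]
  calc _ ≤ gaussianNoise p σ ({b | w + b ∈ T ∩ A} ∪ {b | w + b ∈ Aᶜ}) := by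
        refine measure_mono fun b hb => ?_
        by_cases h : w + b ∈ A
        · exact Or.inl ⟨hb, h⟩
        · exact Or.inr h
    _ ≤ _ := (measure_union_le _ _).trans (add_le_add hgood hbad)

/-- **The Gaussian mechanism is (ε,δ)-differentially private.**
If `M` has ℓ2-sensitivity at most `Δ` over adjacent datasets, `0 < ε < 1`, `0 < δ < 1`, and
`σ ≥ √(2 log(1.25/δ)) Δ / ε`, then for all adjacent datasets `x, x'` and every Borel set
`S ⊆ ℝ^p`, `P(M(x) + b ∈ S) ≤ e^ε P(M(x') + b ∈ S) + δ` where `b ~ N(0, σ² I_p)`. -/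
theorem gaussian_mechanism_is_DP
    {𝒳 : Type*} {n p : ℕ}
    (M : (Fin n → 𝒳) → (Fin p → ℝ))
    (Δ ε δ σ : ℝ)
    (hε : 0 < ε) (hε1 : ε < 1) (hδ : 0 < δ) (hδ1 : δ < 1)
    (hsens : ∀ x x' : Fin n → 𝒳, Adjacent x x' →
      Real.sqrt (∑ l, (M x l - M x' l) ^ 2) ≤ Δ)
    (hσ : σ ≥ Real.sqrt (2 * Real.log (1.25 / δ)) * Δ / ε) :
    ∀ x x' : Fin n → 𝒳, Adjacent x x' →
      ∀ S : Set (Fin p → ℝ), MeasurableSet S →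
        gaussianNoise p σ {b | M x + b ∈ S} ≤
          ENNReal.ofReal (Real.exp ε) * gaussianNoise p σ {b | M x' + b ∈ S} +
            ENNReal.ofReal δ := by
  intro x x' hadj S hS
  have hd := hsens x x' hadj
  rcases (Real.sqrt_nonneg (∑ l, (M x l - M x' l) ^ 2)).eq_or_lt with h0 | h0
  · have hM : M x = M x' := by
      have hsum := (Real.sqrt_eq_zero (Finset.sum_nonneg fun l _ => sq_nonneg _)).1 h0.symm
      rw [Finset.sum_eq_zero_iff_of_nonneg fun l _ => sq_nonneg _] at hsum
      ext l
      exact sub_eq_zero.1 (pow_eq_zero_iff two_ne_zero |>.1 (hsum l (Finset.mem_univ l)))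
    rw [hM]
    refine le_add_right (le_mul_of_one_le_left' ?_)
    exact ENNReal.one_le_ofReal.2 (one_le_exp hε.le)
  · have hT : MeasurableSet {b | M x' + b ∈ S} := (measurable_const_add (M x')) hS
    have hσ' : √(2 * log (1.25 / δ)) * √(∑ l, (M x - M x') l ^ 2) / ε ≤ σ :=
      le_trans (by gcongr; exact hd) hσ
    convert gaussianNoise_preimage_add_le hε hε1 hδ hδ1 h0 hσ' hT using 2
    ext b
    have hb : M x' + ((fun i => M x i - M x' i) + b) = M x + b := by
      ext i
      simp only [Pi.add_apply]
      ring
    change M x + b ∈ S ↔ M x' + ((fun i => M x i - M x' i) + b) ∈ S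
    rw [hb]
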